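/- arXiv:2308.02269 — 2 statements merged into one kernel-verified Lean document; each statement's English description precedes it below -/
import Mathlib

section
/- Let E be a type, P₋, P₊ ⊆ E, and l a nonempty list over E. Then l is (−)-canonical if and only if l is (+)-canonical; that is, l either consists entirely of elements of P₋ or admits a (−)-canonical factoring, if and only if l either consists entirely of elements of P₊ or admits a (+)-canonical factoring. -/
/-- The list `l` has a (−)-canonical factoring at index `k`: all elements before
`k` belong to `Pm`, the element at `k` is not in `Pm`, and all elements after `k`
belong to `Pp`. -/
def HasCanonMinusFactoringAt {E : Type*} (Pm Pp : Set E) (l : List E) (k : Fin l.length) : Prop :=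
  (∀ i : Fin l.length, i < k → l.get i ∈ Pm) ∧ l.get k ∉ Pm ∧
    ∀ i : Fin l.length, k < i → l.get i ∈ Pp

/-- The list `l` has a (+)-canonical factoring at index `m`: all elements before
`m` belong to `Pm`, the element at `m` is not in `Pp`, and all elements after `m`
belong to `Pp`. -/
def HasCanonPlusFactoringAt {E : Type*} (Pm Pp : Set E) (l : List E) (m : Fin l.length) : Prop :=
  (∀ i : Fin l.length, i < m → l.get i ∈ Pm) ∧ l.get m ∉ Pp ∧
    ∀ i : Fin l.length, m < i → l.get i ∈ Pp

/-- `l` is (−)-canonical: all its elements belong to `Pm`, or it has a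
(−)-canonical factoring at some index. -/
def IsCanonMinus {E : Type*} (Pm Pp : Set E) (l : List E) : Prop :=
  (∀ x ∈ l, x ∈ Pm) ∨ ∃ k : Fin l.length, HasCanonMinusFactoringAt Pm Pp l k

/-- `l` is (+)-canonical: all its elements belong to `Pp`, or it has a
(+)-canonical factoring at some index. -/
def IsCanonPlus {E : Type*} (Pm Pp : Set E) (l : List E) : Prop :=
  (∀ x ∈ l, x ∈ Pp) ∨ ∃ m : Fin l.length, HasCanonPlusFactoringAt Pm Pp l m

/-- `l` is (−)-canonical iff some index has only elements of `Pm` before it and only elements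
of `Pp` after it. -/
theorem isCanonMinus_iff_exists_pivot {E : Type*} (Pm Pp : Set E) (l : List E) (hl : l ≠ []) :
    IsCanonMinus Pm Pp l ↔ ∃ k : Fin l.length,
      (∀ i, i < k → l.get i ∈ Pm) ∧ ∀ i, k < i → l.get i ∈ Pp := by
  have hpos := List.length_pos_iff.mpr hl
  constructor
  · rintro (h | ⟨k, hk, -, hk'⟩)
    · refine ⟨⟨l.length - 1, by omega⟩, fun i _ => h _ (l.get_mem i), fun i hi => ?_⟩
      have := i.isLt
      simp only [Fin.lt_def] at hi
      omega
    · exact ⟨k, hk, hk'⟩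
  · rintro ⟨k, hk, hk'⟩
    by_cases h : ∀ i, l.get i ∈ Pm
    · exact Or.inl (fun x hx => by obtain ⟨i, rfl⟩ := List.get_of_mem hx; exact h i)
    · push Not at h
      obtain ⟨j, hj, hmin⟩ := wellFounded_lt.has_min {i | l.get i ∉ Pm} h
      refine Or.inr ⟨j, fun i hi => by_contra fun hi' => hmin i hi' hi, hj, fun i hi => hk' i ?_⟩
      exact (not_lt.mp fun hjk => hj (hk j hjk)).trans_lt hi

/-- `l` is (+)-canonical iff some index has only elements of `Pm` before it and only elements
of `Pp` after it. -/
theorem isCanonPlus_iff_exists_pivot {E : Type*} (Pm Pp : Set E) (l : List E) (hl : l ≠ []) :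
    IsCanonPlus Pm Pp l ↔ ∃ k : Fin l.length,
      (∀ i, i < k → l.get i ∈ Pm) ∧ ∀ i, k < i → l.get i ∈ Pp := by
  have hpos := List.length_pos_iff.mpr hl
  constructor
  · rintro (h | ⟨k, hk, -, hk'⟩)
    · refine ⟨⟨0, hpos⟩, fun i hi => ?_, fun i _ => h _ (l.get_mem i)⟩
      simp only [Fin.lt_def] at hi
      omega
    · exact ⟨k, hk, hk'⟩
  · rintro ⟨k, hk, hk'⟩
    by_cases h : ∀ i, l.get i ∈ Pp
    · exact Or.inl (fun x hx => by obtain ⟨i, rfl⟩ := List.get_of_mem hx; exact h i)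
    · push Not at h
      obtain ⟨j, hj, hmax⟩ := wellFounded_gt.has_min {i | l.get i ∉ Pp} h
      refine Or.inr ⟨j, fun i hi => hk i ?_, hj, fun i hi => by_contra fun hi' => hmax i hi' hi⟩
      exact hi.trans_le (not_lt.mp fun hkj => hj (hk' j hkj))

/-- A nonempty list is (−)-canonical if and only if it is (+)-canonical. -/
theorem isCanonMinus_iff_isCanonPlus {E : Type*} (Pm Pp : Set E) (l : List E)
    (hl : l ≠ []) : IsCanonMinus Pm Pp l ↔ IsCanonPlus Pm Pp l := by
  rw [isCanonMinus_iff_exists_pivot Pm Pp l hl, isCanonPlus_iff_exists_pivot Pm Pp l hl]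
end

section
/- Let F be a prefix-free set of nonempty strings over Σ such that every suffix of T has some element of F as a prefix. Then: (1) every suffix of T has exactly one element of F as a prefix; and (2) for any suffixes S₁ ≤lex S₂ ≤lex S₃ of T, if the same P ∈ F is a prefix of both S₁ and S₃, then P is also a prefix of S₂. Consequently, the SA-intervals of the elements of F form an ordered partition of the rank space [1..n]: they are pairwise disjoint, cover [1..n], and are consecutive intervals ordered by the lexicographic order of the elements of F. -/
theorem List.isPrefix_of_lex_between {σ : Type*} [LinearOrder σ] :
    ∀ {P S₁ S₂ S₃ : List σ},
      (S₁ = S₂ ∨ List.Lex (· < ·) S₁ S₂) → (S₂ = S₃ ∨ List.Lex (· < ·) S₂ S₃) →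
      P <+: S₁ → P <+: S₃ → P <+: S₂
  | [], _, _, _, _, _, _, _ => List.nil_prefix
  | a :: P, S₁, S₂, S₃, h₁₂, h₂₃, h₁, h₃ => by
    obtain ⟨U, rfl⟩ := h₁
    obtain ⟨V, rfl⟩ := h₃
    rcases h₁₂ with rfl | h₁₂
    · exact List.prefix_append _ _
    rcases h₂₃ with rfl | h₂₃
    · exact List.prefix_append _ _
    rw [List.cons_append] at h₁₂ h₂₃
    cases h₁₂ with
    | rel hab =>
      cases h₂₃ with
      | rel hba => exact absurd hab hba.asymm
      | cons _ => exact absurd hab (lt_irrefl _)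
    | cons h₁₂ =>
      cases h₂₃ with
      | rel haa => exact absurd haa (lt_irrefl _)
      | cons h₂₃ =>
        exact List.cons_prefix_cons.2 ⟨rfl, isPrefix_of_lex_between (.inr h₁₂) (.inr h₂₃)
          (List.prefix_append _ _) (List.prefix_append _ _)⟩

theorem List.Lex.of_isPrefix {α : Type*} {r : α → α → Prop} {P Q S S' : List α}
    (h : List.Lex r P Q) (hPQ : ¬ P <+: Q) (hP : P <+: S) (hQ : Q <+: S') :
    List.Lex r S S' := by
  obtain ⟨U, rfl⟩ := hP
  obtain ⟨V, rfl⟩ := hQ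
  induction h with
  | nil => exact absurd List.nil_prefix hPQ
  | rel hab => exact .rel hab
  | cons _ ih => exact .cons (ih fun h => hPQ (List.cons_prefix_cons.2 ⟨rfl, h⟩))

/-- Let `F` be a prefix-free set of nonempty strings such that every suffix of
`T` has some element of `F` as a prefix, and let `SA` be the suffix array of
`T` (a permutation of the positions listing the suffixes in strictly increasing
lexicographic order). Then:
(1) every suffix of `T` has exactly one element of `F` as a prefix;
(2) for suffixes `S₁ ≤lex S₂ ≤lex S₃`, if some `P ∈ F` is a prefix of both `S₁`
and `S₃`, then `P` is a prefix of `S₂`;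
(3) the SA-interval of each `P ∈ F` is a set of consecutive ranks (convex); and
(4) the SA-intervals are ordered according to the lexicographic order of the
elements of `F` (together with (1), they are pairwise disjoint and, with the
covering hypothesis, they cover the whole rank space). -/
theorem prefixFree_cover_ordered_partition {σ : Type*} [LinearOrder σ]
    (T : List σ) (hn : 1 ≤ T.length)
    (SA : Equiv.Perm (Fin T.length))
    (hSA : ∀ k l : Fin T.length, k < l →
      List.Lex (· < ·) (T.drop (SA k).val) (T.drop (SA l).val))
    (F : Set (List σ)) (hne : ∀ P ∈ F, P ≠ [])
    (hpf : ∀ P ∈ F, ∀ Q ∈ F, P <+: Q → P = Q)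
    (hcov : ∀ p : Fin T.length, ∃ P ∈ F, P <+: T.drop p.val) :
    (∀ p : Fin T.length, ∃! P, P ∈ F ∧ P <+: T.drop p.val) ∧
    (∀ P ∈ F, ∀ p₁ p₂ p₃ : Fin T.length,
      (T.drop p₁.val = T.drop p₂.val ∨ List.Lex (· < ·) (T.drop p₁.val) (T.drop p₂.val)) →
      (T.drop p₂.val = T.drop p₃.val ∨ List.Lex (· < ·) (T.drop p₂.val) (T.drop p₃.val)) →
      P <+: T.drop p₁.val → P <+: T.drop p₃.val → P <+: T.drop p₂.val) ∧
    (∀ P ∈ F, ∀ k₁ k₂ k₃ : Fin T.length, k₁ ≤ k₂ → k₂ ≤ k₃ →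
      P <+: T.drop (SA k₁).val → P <+: T.drop (SA k₃).val → P <+: T.drop (SA k₂).val) ∧
    (∀ P ∈ F, ∀ Q ∈ F, List.Lex (· < ·) P Q →
      ∀ k l : Fin T.length, P <+: T.drop (SA k).val → Q <+: T.drop (SA l).val → k < l) := by
  have huniq : ∀ P ∈ F, ∀ Q ∈ F, ∀ S : List σ, P <+: S → Q <+: S → P = Q := by
    intro P hP Q hQ S hPS hQS
    rcases List.prefix_or_prefix_of_prefix hPS hQS with h | h
    · exact hpf P hP Q hQ h
    · exact (hpf Q hQ P hP h).symm
  have hle : ∀ k l : Fin T.length, k ≤ l → T.drop (SA k).val = T.drop (SA l).val ∨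
      List.Lex (· < ·) (T.drop (SA k).val) (T.drop (SA l).val) := by
    intro k l hkl
    rcases hkl.eq_or_lt with rfl | h
    · exact .inl rfl
    · exact .inr (hSA k l h)
  refine ⟨fun p => ?_, fun P _ _ _ _ h₁₂ h₂₃ => List.isPrefix_of_lex_between h₁₂ h₂₃,
    fun P _ _ _ _ h₁₂ h₂₃ => List.isPrefix_of_lex_between (hle _ _ h₁₂) (hle _ _ h₂₃), ?_⟩
  · obtain ⟨P, hP, hPp⟩ := hcov p
    exact ⟨P, ⟨hP, hPp⟩, fun Q hQ => huniq Q hQ.1 P hP _ hQ.2 hPp⟩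
  · intro P hP Q hQ hPQ k l hk hl
    have hnot : ¬ P <+: Q := by
      intro h
      obtain rfl := hpf P hP Q hQ h
      exact irrefl_of (List.Lex (· < ·)) P hPQ
    have hlex := hPQ.of_isPrefix hnot hk hl
    by_contra! hlk
    rcases hle l k hlk with h | h
    · exact irrefl_of (List.Lex (· < ·)) _ (h ▸ hlex)
    · exact asymm_of (List.Lex (· < ·)) h hlex
end
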